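/- Let Γ be an inverse semigroup and let x, y ∈ Γ have a common successor z (i.e. x ≺ z and y ≺ z). If x and y have a common precessor not equal to zero, then w := x·x⁻¹·y·y⁻¹·x is a largest common precessor of x and y: w ≺ x, w ≺ y, w ≠ 0, w = x·x⁻¹·y·y⁻¹·z, and every r with r ≺ x and r ≺ y satisfies r ≺ w. -/

import Mathlib

/-- An inverse semigroup: a semigroup in which every element `x` has a unique
element `x⁻¹` with `x * x⁻¹ * x = x` and `x⁻¹ * x * x⁻¹ = x⁻¹`. -/
class InverseSemigroup (α : Type*) extends Semigroup α, Inv α where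
  mul_inv_mul : ∀ x : α, x * x⁻¹ * x = x
  inv_mul_inv : ∀ x : α, x⁻¹ * x * x⁻¹ = x⁻¹
  inv_unique : ∀ x y : α, x * y * x = x → y * x * y = y → y = x⁻¹

variable {α : Type*} [InverseSemigroup α]

/-- The natural order on an inverse semigroup: `x ≺ y` iff `x * y⁻¹ = x * x⁻¹`. -/
def prec (x y : α) : Prop := x * y⁻¹ = x * x⁻¹

/-- The idempotents (units) `Γ⁽⁰⁾`: elements `p` with `p = p * p⁻¹`. -/
def IsIdem (p : α) : Prop := p = p * p⁻¹

/-- A zero element: `z * x = z = x * z` for every `x`. -/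
def IsZeroEl (z : α) : Prop := ∀ x : α, z * x = z ∧ x * z = z


namespace InverseSemigroup

theorem inv_inv' (x : α) : x⁻¹⁻¹ = x :=
  (inv_unique x⁻¹ x (inv_mul_inv x) (mul_inv_mul x)).symm

theorem isIdempotentElem_mul_inv (x : α) : IsIdempotentElem (x * x⁻¹) := by
  rw [IsIdempotentElem, ← mul_assoc, mul_inv_mul]

theorem isIdempotentElem_inv_mul (x : α) : IsIdempotentElem (x⁻¹ * x) := by
  rw [IsIdempotentElem, ← mul_assoc, inv_mul_inv]

theorem inv_eq_self_of_isIdempotentElem {e : α} (he : IsIdempotentElem e) : e⁻¹ = e :=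
  (inv_unique e e (by rw [he.eq, he.eq]) (by rw [he.eq, he.eq])).symm

theorem isIdempotentElem_mul {e f : α} (he : IsIdempotentElem e) (hf : IsIdempotentElem f) :
    IsIdempotentElem (e * f) := by
  have hinv : f * (e * f)⁻¹ * e = (e * f)⁻¹ := by
    apply inv_unique
    · calc e * f * (f * (e * f)⁻¹ * e) * (e * f)
          = e * (f * f) * (e * f)⁻¹ * (e * e) * f := by simp only [mul_assoc]
        _ = e * f * (e * f)⁻¹ * (e * f) := by rw [he.eq, hf.eq]; simp only [mul_assoc]
        _ = e * f := mul_inv_mul _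
    · calc f * (e * f)⁻¹ * e * (e * f) * (f * (e * f)⁻¹ * e)
          = f * (e * f)⁻¹ * (e * e) * (f * f) * (e * f)⁻¹ * e := by simp only [mul_assoc]
        _ = f * ((e * f)⁻¹ * (e * f) * (e * f)⁻¹) * e := by
          rw [he.eq, hf.eq]; simp only [mul_assoc]
        _ = f * (e * f)⁻¹ * e := by rw [inv_mul_inv]
  have hidem : IsIdempotentElem (e * f)⁻¹ := by
    calc (e * f)⁻¹ * (e * f)⁻¹
        = f * (e * f)⁻¹ * e * (f * (e * f)⁻¹ * e) := by rw [hinv]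
      _ = f * ((e * f)⁻¹ * (e * f) * (e * f)⁻¹) * e := by simp only [mul_assoc]
      _ = (e * f)⁻¹ := by rw [inv_mul_inv, hinv]
  have heq := inv_eq_self_of_isIdempotentElem hidem
  rw [inv_inv'] at heq
  rwa [← heq] at hidem

theorem mul_comm_of_isIdempotentElem {e f : α} (he : IsIdempotentElem e)
    (hf : IsIdempotentElem f) : e * f = f * e := by
  have key : ∀ {a b : α}, IsIdempotentElem a → IsIdempotentElem b →
      a * b * (b * a) * (a * b) = a * b := by
    intro a b ha hb
    calc a * b * (b * a) * (a * b) = a * (b * b) * (a * a) * b := by simp only [mul_assoc]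
      _ = a * b * (a * b) := by rw [ha.eq, hb.eq]; simp only [mul_assoc]
      _ = a * b := isIdempotentElem_mul ha hb
  rw [inv_unique (e * f) (f * e) (key he hf) (key hf he),
    inv_eq_self_of_isIdempotentElem (isIdempotentElem_mul he hf)]

theorem mul_inv_rev' (x y : α) : (x * y)⁻¹ = y⁻¹ * x⁻¹ := by
  have key : ∀ a b : α, a * b * (b⁻¹ * a⁻¹) * (a * b) = a * b := by
    intro a b
    calc a * b * (b⁻¹ * a⁻¹) * (a * b)
        = a * ((b * b⁻¹) * (a⁻¹ * a)) * b := by simp only [mul_assoc]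
      _ = (a * a⁻¹ * a) * (b * b⁻¹ * b) := by
        rw [mul_comm_of_isIdempotentElem (isIdempotentElem_mul_inv b)
          (isIdempotentElem_inv_mul a)]
        simp only [mul_assoc]
      _ = a * b := by rw [mul_inv_mul, mul_inv_mul]
  refine (inv_unique _ _ (key x y) ?_).symm
  simpa only [inv_inv'] using key y⁻¹ x⁻¹

theorem prec_mul_left {e : α} (he : IsIdempotentElem e) (y : α) : prec (e * y) y := by
  rw [prec, mul_inv_rev', inv_eq_self_of_isIdempotentElem he]
  calc e * y * y⁻¹ = e * e * (y * y⁻¹) := by rw [he.eq, mul_assoc]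
    _ = e * (y * y⁻¹ * e) := by
      rw [mul_assoc, mul_comm_of_isIdempotentElem he (isIdempotentElem_mul_inv y)]
    _ = e * y * (y⁻¹ * e) := by simp only [mul_assoc]

end InverseSemigroup

theorem prec.eq_mul {x y : α} (h : prec x y) : x = x * x⁻¹ * y := by
  have hinv : y * x⁻¹ = x * x⁻¹ := by
    have := congrArg (·⁻¹) h
    simpa only [InverseSemigroup.mul_inv_rev', InverseSemigroup.inv_inv'] using this
  have hx : x = y * (x⁻¹ * x) := by
    rw [← mul_assoc, hinv, InverseSemigroup.mul_inv_mul]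
  calc x = y * (x⁻¹ * x) := hx
    _ = y * ((y⁻¹ * y) * (x⁻¹ * x)) := by
      rw [← mul_assoc y (y⁻¹ * y), ← mul_assoc y y⁻¹ y, InverseSemigroup.mul_inv_mul]
    _ = y * (x⁻¹ * x) * y⁻¹ * y := by
      rw [InverseSemigroup.mul_comm_of_isIdempotentElem
        (InverseSemigroup.isIdempotentElem_inv_mul y)
        (InverseSemigroup.isIdempotentElem_inv_mul x)]
      simp only [mul_assoc]
    _ = x * x⁻¹ * y := by rw [← hx, h]

theorem prec.eq_mul_of_prec {r x y : α} (hx : prec r x) (hy : prec r y) :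
    r = r * r⁻¹ * (x * x⁻¹ * y * y⁻¹ * x) := by
  have absorb : ∀ {a : α}, prec r a → r * r⁻¹ * (a * a⁻¹) = r * r⁻¹ := by
    intro a ha
    rw [← mul_assoc, ← ha.eq_mul, ha]
  calc r = r * r⁻¹ * x := hx.eq_mul
    _ = r * r⁻¹ * (x * x⁻¹) * (y * y⁻¹) * x := by rw [absorb hx, absorb hy]
    _ = r * r⁻¹ * (x * x⁻¹ * y * y⁻¹ * x) := by simp only [mul_assoc]

/-- if x, y have a common successor s and a common precessor v ≠ 0,
then w := x·x⁻¹·y·y⁻¹·x is a largest common precessor of x and y, is nonzero and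
equals x·x⁻¹·y·y⁻¹·s. -/
theorem stmt5 {z : α} (hz : IsZeroEl z)
    {x y s v : α} (hxs : prec x s) (hys : prec y s)
    (hvx : prec v x) (hvy : prec v y) (hv : v ≠ z) :
    prec (x * x⁻¹ * y * y⁻¹ * x) x ∧
    prec (x * x⁻¹ * y * y⁻¹ * x) y ∧
    x * x⁻¹ * y * y⁻¹ * x ≠ z ∧
    x * x⁻¹ * y * y⁻¹ * x = x * x⁻¹ * y * y⁻¹ * s ∧
    ∀ r : α, prec r x → prec r y → prec r (x * x⁻¹ * y * y⁻¹ * x) := by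
  have hx := InverseSemigroup.isIdempotentElem_mul_inv x
  have hy := InverseSemigroup.isIdempotentElem_mul_inv y
  have hws : x * x⁻¹ * y * y⁻¹ * x = x * x⁻¹ * y * y⁻¹ * s := by
    calc x * x⁻¹ * y * y⁻¹ * x = x * x⁻¹ * y * y⁻¹ * (x * x⁻¹ * s) := by rw [← hxs.eq_mul]
      _ = x * x⁻¹ * ((y * y⁻¹) * (x * x⁻¹)) * s := by simp only [mul_assoc]
      _ = (x * x⁻¹) * (x * x⁻¹) * (y * y⁻¹) * s := by
        rw [InverseSemigroup.mul_comm_of_isIdempotentElem hy hx]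
        simp only [mul_assoc]
      _ = x * x⁻¹ * y * y⁻¹ * s := by rw [hx.eq]; simp only [mul_assoc]
  refine ⟨?_, ?_, ?_, hws, ?_⟩
  · simpa only [mul_assoc] using
      InverseSemigroup.prec_mul_left (InverseSemigroup.isIdempotentElem_mul hx hy) x
  · have hwy : x * x⁻¹ * y * y⁻¹ * x = x * x⁻¹ * y := by
      rw [hws]
      calc x * x⁻¹ * y * y⁻¹ * s = x * x⁻¹ * (y * y⁻¹ * s) := by simp only [mul_assoc]
        _ = x * x⁻¹ * y := by rw [← hys.eq_mul]
    rw [hwy]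
    exact InverseSemigroup.prec_mul_left hx y
  · intro hw
    apply hv
    rw [hvx.eq_mul_of_prec hvy, hw, (hz _).2]
  · intro r hrx hry
    have h := InverseSemigroup.prec_mul_left (InverseSemigroup.isIdempotentElem_mul_inv r)
      (x * x⁻¹ * y * y⁻¹ * x)
    rwa [← hrx.eq_mul_of_prec hry] at h
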